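/- arXiv:1407.5709 — 2 statements merged into one kernel-verified Lean document; each statement's English description precedes it below -/
import Mathlib

section
/- Let p be a prime, N a positive integer with p ∤ N, and 1 ≤ i ≤ r integers. For 0 ≤ j < p^{r−i} set ϱ_j := ((1,0),(jNp^i,1)) ∈ SL(2,ℤ). Then Γ1(Np^i) is the disjoint union, over j = 0, 1, …, p^{r−i}−1, of the right cosets (Γ1(Np^i) ∩ Γ0(p^r))·ϱ_j; in particular, the matrices ϱ_j form a complete system of representatives for the right cosets of Γ1(Np^i) ∩ Γ0(p^r) in Γ1(Np^i). -/
open scoped MatrixGroups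
open CongruenceSubgroup

/-- The unipotent matrix `ϱ_c = ((1,0),(c,1))` as an element of `SL(2, ℤ)`. -/
def lowerUnipotent (c : ℤ) : SL(2, ℤ) :=
  ⟨!![1, 0; c, 1], by simp [Matrix.det_fin_two_of]⟩

theorem existsUnique_fin_dvd_sub_mul {m : ℕ} (hm : 0 < m) {d : ℤ} (hd : IsCoprime d m) (c : ℤ) :
    ∃! j : Fin m, (m : ℤ) ∣ c - d * ((j : ℕ) : ℤ) := by
  have hm' : (0 : ℤ) < m := by exact_mod_cast hm
  obtain ⟨u, v, huv⟩ := hd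
  have hnonneg := Int.emod_nonneg (c * u) hm'.ne'
  have hlt := Int.emod_lt_of_pos (c * u) hm'
  refine ⟨⟨(c * u % m).toNat, by omega⟩, ?_, fun k hk ↦ ?_⟩
  · simp only [Int.toNat_of_nonneg hnonneg]
    refine ⟨c * v + d * (c * u / m), ?_⟩
    linear_combination -d * Int.emod_add_mul_ediv (c * u) m - c * huv
  · obtain ⟨t, ht⟩ := hk
    have hmod : ((k : ℕ) : ℤ) = c * u % m := by
      have hkm : ((k : ℕ) : ℤ) < m := by exact_mod_cast k.isLt
      rw [← Int.emod_eq_of_lt (Int.natCast_nonneg (k : ℕ)) hkm]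
      refine Int.modEq_iff_dvd.2 ⟨u * t - v * k, ?_⟩
      linear_combination u * ht + (k : ℕ) * huv
    ext
    simp only
    omega

@[simp]
theorem coe_lowerUnipotent (c : ℤ) :
    (lowerUnipotent c : Matrix (Fin 2) (Fin 2) ℤ) = !![1, 0; c, 1] :=
  rfl

theorem lowerUnipotent_inv (c : ℤ) : (lowerUnipotent c)⁻¹ = lowerUnipotent (-c) := by
  ext i j
  fin_cases i <;> fin_cases j <;> simp [Matrix.adjugate_fin_two]

theorem mul_lowerUnipotent_apply_one_zero (g : SL(2, ℤ)) (c : ℤ) :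
    (g * lowerUnipotent c) 1 0 = g 1 0 + g 1 1 * c := by
  simp [Matrix.mul_apply, Fin.sum_univ_two]

theorem lowerUnipotent_mem_Gamma1 {M : ℕ} {c : ℤ} (h : (M : ℤ) ∣ c) :
    lowerUnipotent c ∈ Gamma1 M := by
  simpa [Gamma1_mem, ZMod.intCast_zmod_eq_zero_iff_dvd] using h

/-- **Coset decomposition of `Γ₁(Np^i)` along `Γ₁(Np^i) ∩ Γ₀(p^r)`.**
Let `p` be a prime, `N` a positive integer with `p ∤ N`, and `1 ≤ i ≤ r`.  For
`0 ≤ j < p^(r-i)` set `ϱ_j := ((1,0),(jNp^i,1)) ∈ SL(2,ℤ)`.  Then `Γ₁(Np^i)` is the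
disjoint union of the right cosets `(Γ₁(Np^i) ∩ Γ₀(p^r))·ϱ_j`; that is, every element of
`Γ₁(Np^i)` lies in exactly one of these cosets, so the `ϱ_j` form a complete system of
representatives for the right cosets of `Γ₁(Np^i) ∩ Γ₀(p^r)` in `Γ₁(Np^i)`. -/
theorem gamma1_coset_decomposition_unipotent
    (p N i r : ℕ) (hp : p.Prime) (hN : 0 < N) (hpN : ¬ p ∣ N) (hi : 1 ≤ i) (hir : i ≤ r) :
    ∀ g ∈ Gamma1 (N * p ^ i),
      ∃! j : Fin (p ^ (r - i)),
        g * (lowerUnipotent ((j : ℤ) * N * p ^ i))⁻¹ ∈ Gamma1 (N * p ^ i) ⊓ Gamma0 (p ^ r) := by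
  intro g hg
  have hpz : Prime (p : ℤ) := Nat.prime_iff_prime_int.1 hp
  obtain ⟨-, hd, hc⟩ := (Gamma1_mem _ _).1 hg
  obtain ⟨c, hc⟩ := (ZMod.intCast_zmod_eq_zero_iff_dvd _ _).1 hc
  have hd : ((N * p ^ i : ℕ) : ℤ) ∣ g 1 1 - 1 := by
    rw [← ZMod.intCast_zmod_eq_zero_iff_dvd]
    simp [hd]
  push_cast at hc hd
  have hpd : IsCoprime (g 1 1) ((p ^ (r - i) : ℕ) : ℤ) := by
    push_cast
    refine IsCoprime.pow_right ?_
    obtain ⟨t, ht⟩ := (Dvd.intro_left _ rfl : (p : ℤ) ^ i ∣ N * p ^ i).trans hd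
    obtain ⟨s, rfl⟩ := Nat.exists_eq_add_of_le' hi
    exact ⟨1, -(p ^ s * t), by linear_combination ht⟩
  have hNp : IsCoprime ((p : ℤ) ^ (r - i)) N :=
    (Nat.isCoprime_iff_coprime.2 ((Nat.Prime.coprime_iff_not_dvd hp).2 hpN)).pow_left
  have hmem (j : Fin (p ^ (r - i))) :
      g * (lowerUnipotent ((j : ℤ) * N * p ^ i))⁻¹ ∈ Gamma1 (N * p ^ i) ⊓ Gamma0 (p ^ r) ↔
        ((p ^ (r - i) : ℕ) : ℤ) ∣ c - g 1 1 * ((j : ℕ) : ℤ) := by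
    have h1 : g * (lowerUnipotent ((j : ℤ) * N * p ^ i))⁻¹ ∈ Gamma1 (N * p ^ i) :=
      mul_mem hg <| inv_mem <| lowerUnipotent_mem_Gamma1 ⟨j, by push_cast; ring⟩
    have hpi : (p : ℤ) ^ i ≠ 0 := pow_ne_zero _ hpz.ne_zero
    have hentry : g 1 0 + g 1 1 * -((j : ℤ) * N * p ^ i) =
        p ^ i * (N * (c - g 1 1 * ((j : ℕ) : ℤ))) := by
      rw [hc]
      ring
    rw [Subgroup.mem_inf, and_iff_right h1, Gamma0_mem, lowerUnipotent_inv,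
      mul_lowerUnipotent_apply_one_zero, ZMod.intCast_zmod_eq_zero_iff_dvd, hentry]
    push_cast
    rw [← pow_mul_pow_sub (p : ℤ) hir, mul_dvd_mul_iff_left hpi]
    exact ⟨hNp.dvd_of_dvd_mul_left, fun h ↦ h.mul_left _⟩
  simp only [hmem]
  exact existsUnique_fin_dvd_sub_mul (pow_pos hp.pos _) hpd c
end

section
/- Let p be a prime, N a positive integer with p ∤ N, and 1 ≤ i ≤ r integers. Let S := {x ∈ (ℤ/p^rℤ)^× : x ≡ 1 (mod p^i)}, and for each δ ∈ S let σ_δ be any element of Γ1(Np^i) ∩ Γ0(p^r) whose lower-right entry is congruent to δ modulo p^r. For 0 ≤ j < p^{r−i} set ϱ_j := ((1,0),(jNp^i,1)) ∈ SL(2,ℤ). Then Γ1(Np^i) is the disjoint union of the p^{2(r−i)} right cosets Γ1(Np^r)·σ_δ·ϱ_j, for δ ∈ S and j = 0, 1, …, p^{r−i}−1; that is, the matrices σ_δ·ϱ_j form a complete system of representatives for the right cosets of Γ1(Np^r) in Γ1(Np^i). -/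
open scoped MatrixGroups
open CongruenceSubgroup

theorem mem_Gamma1_iff_dvd {M : ℕ} {A : SL(2, ℤ)} :
    A ∈ Gamma1 M ↔ (M : ℤ) ∣ A 1 0 ∧ (M : ℤ) ∣ A 1 1 - 1 := by
  rw [Gamma1_mem, ← CharP.intCast_eq_zero_iff (ZMod M) M,
    ← CharP.intCast_eq_zero_iff (ZMod M) M]
  have hdet : ((A 0 0 * A 1 1 - A 0 1 * A 1 0 : ℤ) : ZMod M) = ((1 : ℤ) : ZMod M) := by
    rw [← Matrix.det_fin_two, A.det_coe]
  push_cast at hdet ⊢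
  rw [sub_eq_zero]
  constructor
  · rintro ⟨_, h, h'⟩
    exact ⟨h', h⟩
  · rintro ⟨h, h'⟩
    refine ⟨?_, h', h⟩
    simpa [h, h'] using hdet

theorem mem_Gamma1_mul_iff {N m n : ℕ} (hNn : Nat.Coprime N n) {A : SL(2, ℤ)}
    (hA : A ∈ Gamma1 (N * m)) :
    A ∈ Gamma1 (N * n) ↔ (n : ℤ) ∣ A 1 0 ∧ (n : ℤ) ∣ A 1 1 - 1 := by
  have hco : IsCoprime (N : ℤ) (n : ℤ) := Nat.isCoprime_iff_coprime.mpr hNn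
  rw [mem_Gamma1_iff_dvd] at hA ⊢
  push_cast at hA ⊢
  constructor
  · rintro ⟨h, h'⟩
    exact ⟨(Dvd.intro_left _ rfl).trans h, (Dvd.intro_left _ rfl).trans h'⟩
  · rintro ⟨h, h'⟩
    exact ⟨hco.mul_dvd ((Dvd.intro _ rfl).trans hA.1) h,
      hco.mul_dvd ((Dvd.intro _ rfl).trans hA.2) h'⟩

theorem card_ker_unitsMap_prime_pow {p i r : ℕ} (hp : p.Prime) (hi : 1 ≤ i) (hir : i ≤ r) :
    Nat.card (ZMod.unitsMap (pow_dvd_pow p hir)).ker = p ^ (r - i) := by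
  have : NeZero (p ^ r) := ⟨pow_ne_zero _ hp.ne_zero⟩
  have : NeZero (p ^ i) := ⟨pow_ne_zero _ hp.ne_zero⟩
  have h := (ZMod.unitsMap (pow_dvd_pow p hir)).ker.card_mul_index
  rw [Subgroup.index_ker, MonoidHom.range_eq_top.mpr (ZMod.unitsMap_surjective _),
    Subgroup.card_top, Nat.card_eq_fintype_card (α := (ZMod (p ^ i))ˣ),
    Nat.card_eq_fintype_card (α := (ZMod (p ^ r))ˣ),
    ZMod.card_units_eq_totient, ZMod.card_units_eq_totient,
    Nat.totient_prime_pow hp hi, Nat.totient_prime_pow hp (hi.trans hir)] at h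
  have hpos : 0 < p ^ (i - 1) * (p - 1) :=
    Nat.mul_pos (pow_pos hp.pos _) (Nat.sub_pos_of_lt hp.one_lt)
  refine Nat.eq_of_mul_eq_mul_right hpos (h.trans ?_)
  rw [← mul_assoc, ← pow_add]
  congr 2
  omega

theorem exists_unique_fin_mul_modEq {n : ℕ} (hn : 0 < n) {d : ℤ} (hd : IsCoprime d n) (c : ℤ) :
    ∃! j : Fin n, (n : ℤ) ∣ c - d * (j : ℤ) := by
  have : NeZero n := ⟨hn.ne'⟩
  obtain ⟨u, v, huv⟩ := hd
  have hn' : (0 : ℤ) < n := by exact_mod_cast hn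
  have hmod := Int.emod_nonneg (u * c) hn'.ne'
  have hlt := Int.emod_lt_of_pos (u * c) hn'
  refine ⟨⟨((u * c) % n).toNat, by omega⟩, ?_, ?_⟩
  · simp only [Int.toNat_of_nonneg hmod]
    refine ⟨c * v + d * (u * c / n), ?_⟩
    have := Int.emod_add_mul_ediv (u * c) n
    linear_combination (-c) * huv - d * this
  · rintro ⟨k, hk⟩ ⟨t, ht⟩
    ext
    have : (k : ℤ) = (u * c) % n := by
      rw [← Int.emod_eq_of_lt (a := (k : ℤ)) (b := n) (by omega) (by exact_mod_cast hk)]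
      refine Int.ModEq.symm ((Int.modEq_iff_dvd).mpr ⟨v * k - u * t, ?_⟩)
      simp only at ht
      linear_combination (-k : ℤ) * huv - u * ht
    simp only
    omega

theorem mul_inv_lower_row (h s : SL(2, ℤ)) :
    (h * s⁻¹) 1 0 = h 1 0 * s 1 1 - h 1 1 * s 1 0 ∧
      (h * s⁻¹) 1 1 = h 1 1 * s 0 0 - h 1 0 * s 0 1 := by
  rw [Matrix.SpecialLinearGroup.coe_mul, Matrix.SpecialLinearGroup.coe_inv,
    Matrix.adjugate_fin_two]
  constructor <;> simp [Matrix.mul_apply, Fin.sum_univ_two] <;> ring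

theorem mul_lowerUnipotent_inv_lower_row (g : SL(2, ℤ)) (c : ℤ) :
    (g * (lowerUnipotent c)⁻¹) 1 0 = g 1 0 - g 1 1 * c ∧
      (g * (lowerUnipotent c)⁻¹) 1 1 = g 1 1 := by
  rw [(mul_inv_lower_row _ _).1, (mul_inv_lower_row _ _).2]
  simp [lowerUnipotent]

theorem dvd_lower_row_mul_inv_iff {n : ℤ} (h s : SL(2, ℤ)) (hs : n ∣ s 1 0) :
    (n ∣ (h * s⁻¹) 1 0 ∧ n ∣ (h * s⁻¹) 1 1 - 1) ↔ n ∣ h 1 0 ∧ n ∣ h 1 1 - s 1 1 := by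
  have hdet : s 0 0 * s 1 1 - s 0 1 * s 1 0 = 1 := by
    rw [← Matrix.det_fin_two, s.det_coe]
  rw [(mul_inv_lower_row h s).1, (mul_inv_lower_row h s).2]
  obtain ⟨u, hu⟩ := hs
  constructor
  · rintro ⟨⟨x, hx⟩, ⟨y, hy⟩⟩
    have hc : h 1 0 = n * (s 0 0 * x + s 0 0 * h 1 1 * u - s 0 1 * u * h 1 0) := by
      linear_combination (-h 1 0) * hdet + s 0 0 * hx + (s 0 0 * h 1 1 - s 0 1 * h 1 0) * hu
    refine ⟨⟨_, hc⟩, ⟨y * s 1 1 + x * s 0 1, ?_⟩⟩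
    linear_combination (-h 1 1) * hdet + s 1 1 * hy + s 0 1 * hx
  · rintro ⟨⟨x, hx⟩, ⟨y, hy⟩⟩
    refine ⟨⟨x * s 1 1 - h 1 1 * u, ?_⟩, ⟨s 0 0 * y + s 0 1 * u - x * s 0 1, ?_⟩⟩
    · linear_combination s 1 1 * hx - h 1 1 * hu
    · linear_combination hdet + s 0 0 * hy + s 0 1 * hu - s 0 1 * hx

/-- **Coset decomposition of `Γ₁(Np^i)` along `Γ₁(Np^r)`.**
Let `p` be a prime, `N` a positive integer with `p ∤ N`, and `1 ≤ i ≤ r`.  Let `D` be the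
set of units `δ` of `ℤ/p^rℤ` with `δ ≡ 1 (mod p^i)`, and for each `δ ∈ D` let `σ_δ` be any
element of `Γ₁(Np^i) ∩ Γ₀(p^r)` whose lower-right entry is congruent to `δ` mod `p^r`.
For `0 ≤ j < p^(r-i)` set `ϱ_j := ((1,0),(jNp^i,1)) ∈ SL(2,ℤ)`.  Then `D` has exactly
`p^(r-i)` elements, and `Γ₁(Np^i)` is the disjoint union of the `p^(2(r-i))` right cosets
`Γ₁(Np^r)·σ_δ·ϱ_j` for `δ ∈ D`, `0 ≤ j < p^(r-i)`; that is, the matrices `σ_δ·ϱ_j` form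
a complete system of representatives for the right cosets of `Γ₁(Np^r)` in `Γ₁(Np^i)`. -/
theorem gamma1_coset_decomposition_full
    (p N i r : ℕ) (hp : p.Prime) (hN : 0 < N) (hpN : ¬ p ∣ N) (hi : 1 ≤ i) (hir : i ≤ r)
    (D : Finset (ZMod (p ^ r))ˣ)
    (hD : ∀ δ : (ZMod (p ^ r))ˣ,
      δ ∈ D ↔ ZMod.castHom (pow_dvd_pow p hir) (ZMod (p ^ i)) (δ : ZMod (p ^ r)) = 1)
    (σ : (ZMod (p ^ r))ˣ → SL(2, ℤ))
    (hσ : ∀ δ ∈ D, σ δ ∈ Gamma1 (N * p ^ i) ⊓ Gamma0 (p ^ r) ∧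
      (((σ δ) 1 1 : ℤ) : ZMod (p ^ r)) = (δ : ZMod (p ^ r))) :
    D.card = p ^ (r - i) ∧
      ∀ g ∈ Gamma1 (N * p ^ i),
        ∃! x : (ZMod (p ^ r))ˣ × Fin (p ^ (r - i)),
          x.1 ∈ D ∧
            g * (lowerUnipotent ((x.2 : ℤ) * N * p ^ i))⁻¹ * (σ x.1)⁻¹ ∈
              Gamma1 (N * p ^ r) := by
  have : NeZero (p ^ r) := ⟨pow_ne_zero _ hp.ne_zero⟩
  have hDker (δ : (ZMod (p ^ r))ˣ) : δ ∈ D ↔ δ ∈ (ZMod.unitsMap (pow_dvd_pow p hir)).ker := by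
    rw [hD, MonoidHom.mem_ker, Units.ext_iff]
    rfl
  refine ⟨?_, fun g hg => ?_⟩
  · rw [← card_ker_unitsMap_prime_pow hp hi hir, ← Nat.card_eq_finsetCard]
    exact Nat.card_congr (Equiv.subtypeEquivRight hDker)
  have hNp : Nat.Coprime N p := ((Nat.Prime.coprime_iff_not_dvd hp).mpr hpN).symm
  have hpow : (p : ℤ) ^ r = p ^ i * p ^ (r - i) := by rw [← pow_add, Nat.add_sub_cancel' hir]
  have hpi : (p : ℤ) ^ i ≠ 0 := pow_ne_zero _ (by exact_mod_cast hp.ne_zero)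
  have hcoset (δ : (ZMod (p ^ r))ˣ) (hδ : δ ∈ D) (j : Fin (p ^ (r - i))) :
      g * (lowerUnipotent ((j : ℤ) * N * p ^ i))⁻¹ * (σ δ)⁻¹ ∈ Gamma1 (N * p ^ r) ↔
        (p : ℤ) ^ r ∣ g 1 0 - g 1 1 * ((j : ℤ) * N * p ^ i) ∧
          ((g 1 1 : ℤ) : ZMod (p ^ r)) = δ := by
    obtain ⟨⟨hσ₁, hσ₀⟩, hσδ⟩ := hσ δ hδ
    have hρ : lowerUnipotent ((j : ℤ) * N * p ^ i) ∈ Gamma1 (N * p ^ i) :=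
      lowerUnipotent_mem_Gamma1 ⟨j, by push_cast; ring⟩
    have hs : ((p ^ r : ℕ) : ℤ) ∣ (σ δ) 1 0 :=
      (ZMod.intCast_zmod_eq_zero_iff_dvd _ _).mp (Gamma0_mem.mp hσ₀)
    rw [mem_Gamma1_mul_iff (hNp.pow_right r) (mul_mem (mul_mem hg (inv_mem hρ)) (inv_mem hσ₁)),
      dvd_lower_row_mul_inv_iff _ _ hs, (mul_lowerUnipotent_inv_lower_row _ _).1,
      (mul_lowerUnipotent_inv_lower_row _ _).2, ← hσδ, eq_comm (a := ((g 1 1 : ℤ) : ZMod (p ^ r))),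
      ZMod.intCast_eq_intCast_iff_dvd_sub]
    push_cast
    rfl
  obtain ⟨⟨c, hc⟩, ⟨d, hd⟩⟩ := mem_Gamma1_iff_dvd.mp hg
  push_cast at hc hd
  have hgp : IsCoprime (g 1 1) (p : ℤ) := by
    obtain ⟨k, rfl⟩ := Nat.exists_eq_add_of_le' hi
    exact ⟨1, -(N * p ^ k * d), by linear_combination hd⟩
  have hcol (j : Fin (p ^ (r - i))) :
      (p : ℤ) ^ r ∣ g 1 0 - g 1 1 * ((j : ℤ) * N * p ^ i) ↔
        ((p ^ (r - i) : ℕ) : ℤ) ∣ c - g 1 1 * (j : ℤ) := by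
    have hco : IsCoprime ((p : ℤ) ^ (r - i)) (N : ℤ) :=
      (Nat.isCoprime_iff_coprime.mpr hNp.symm).pow_left
    rw [hc, hpow, show (N : ℤ) * p ^ i * c - g 1 1 * ((j : ℤ) * N * p ^ i) =
      p ^ i * (N * (c - g 1 1 * j)) by ring, mul_dvd_mul_iff_left hpi]
    push_cast
    exact ⟨hco.dvd_of_dvd_mul_left, fun h => h.mul_left _⟩
  have hunit : IsUnit ((g 1 1 : ℤ) : ZMod (p ^ r)) := by
    rw [ZMod.coe_int_isUnit_iff_isCoprime]
    push_cast
    exact hgp.pow_right.symm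
  obtain ⟨δ, hδ⟩ := hunit
  have hδD : δ ∈ D := by
    have hdvd : ((p ^ i : ℕ) : ℤ) ∣ g 1 1 - 1 := ⟨N * d, by rw [hd]; push_cast; ring⟩
    rw [hD, hδ, map_intCast]
    simpa [sub_eq_zero] using (ZMod.intCast_zmod_eq_zero_iff_dvd _ (p ^ i)).mpr hdvd
  obtain ⟨j, hj, hj_unique⟩ := exists_unique_fin_mul_modEq (pow_pos hp.pos (r - i))
    (by push_cast; exact hgp.pow_right) c
  refine ⟨(δ, j), ⟨hδD, (hcoset δ hδD j).mpr ⟨(hcol j).mpr hj, hδ.symm⟩⟩, ?_⟩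
  rintro ⟨ε, k⟩ ⟨hε, hk⟩
  obtain ⟨hk₁, hk₂⟩ := (hcoset ε hε k).mp hk
  exact Prod.ext (Units.ext (hk₂.symm.trans hδ.symm)) (hj_unique k ((hcol k).mp hk₁))
end
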